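/- For every integer n ≥ 1 and every x > 0, the Bateman function of order 2n is given by the Rodrigues-type formula k_{2n}(x) = ((−1)^n · x · e^x / n!) · (d^n/dx^n)[x^{n−1} e^{−2x}], where the n-th derivative of the function t ↦ t^{n−1} e^{−2t} is evaluated at x. -/

import Mathlib

/-- The Bateman function `k_ν(x) = (2/π) ∫₀^{π/2} cos(x·tan θ − ν·θ) dθ`. -/
noncomputable def batemanK (ν x : ℝ) : ℝ :=
  (2 / Real.pi) * ∫ θ in (0:ℝ)..(Real.pi / 2), Real.cos (x * Real.tan θ - ν * θ)

open MeasureTheory Set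
open scoped FourierTransform

section CauchyIntegral

lemma integrable_exp_neg_abs :
    Integrable (fun t : ℝ => (Real.exp (-(2 * Real.pi * |t|)) : ℂ)) := by
  have hpi := Real.pi_pos
  rw [← integrableOn_univ, ← Iic_union_Ioi (a := (0 : ℝ))]
  refine IntegrableOn.union ?_ ?_
  · refine (integrableOn_exp_mul_complex_Iic (a := 2 * Real.pi)
      (by simpa using hpi) 0).congr_fun (fun t ht => ?_) measurableSet_Iic
    simp only [mem_Iic] at ht
    simp [abs_of_nonpos ht]
  · refine (integrableOn_exp_mul_complex_Ioi (a := -(2 * Real.pi))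
      (by simpa using hpi) 0).congr_fun (fun t ht => ?_) measurableSet_Ioi
    simp only [mem_Ioi] at ht
    simp [abs_of_pos ht]

lemma fourier_exp_neg_abs (w : ℝ) :
    𝓕 (fun t : ℝ => (Real.exp (-(2 * Real.pi * |t|)) : ℂ)) w =
      (((1 + w ^ 2)⁻¹ / Real.pi : ℝ) : ℂ) := by
  have hpi := Real.pi_pos
  have hpi' : (Real.pi : ℂ) ≠ 0 := by exact_mod_cast hpi.ne'
  set a : ℂ := 2 * Real.pi * (1 - w * Complex.I) with ha
  set b : ℂ := -(2 * Real.pi * (1 + w * Complex.I)) with hb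
  have hare : 0 < a.re := by simp [ha, hpi]
  have hbre : b.re < 0 := by simp [hb, hpi]
  have ea : EqOn (fun t : ℝ => Complex.exp (a * t)) (fun t : ℝ =>
      Complex.exp (↑(-2 * Real.pi * t * w) * Complex.I) •
        (Real.exp (-(2 * Real.pi * |t|)) : ℂ)) (Iic 0) := by
    intro t ht
    simp only [mem_Iic] at ht
    simp only [abs_of_nonpos ht, smul_eq_mul, Complex.ofReal_exp, ← Complex.exp_add]
    congr 1
    push_cast
    rw [ha]
    ring
  have eb : EqOn (fun t : ℝ => Complex.exp (b * t)) (fun t : ℝ =>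
      Complex.exp (↑(-2 * Real.pi * t * w) * Complex.I) •
        (Real.exp (-(2 * Real.pi * |t|)) : ℂ)) (Ioi 0) := by
    intro t ht
    simp only [mem_Ioi] at ht
    simp only [abs_of_pos ht, smul_eq_mul, Complex.ofReal_exp, ← Complex.exp_add]
    congr 1
    push_cast
    rw [hb]
    ring
  rw [Real.fourier_real_eq_integral_exp_smul, ← setIntegral_univ, ← Iic_union_Ioi (a := (0 : ℝ)),
    setIntegral_union (Iic_disjoint_Ioi le_rfl) measurableSet_Ioi
      ((integrableOn_exp_mul_complex_Iic hare 0).congr_fun ea measurableSet_Iic)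
      ((integrableOn_exp_mul_complex_Ioi hbre 0).congr_fun eb measurableSet_Ioi),
    ← setIntegral_congr_fun measurableSet_Iic ea, ← setIntegral_congr_fun measurableSet_Ioi eb,
    integral_exp_mul_complex_Iic hare, integral_exp_mul_complex_Ioi hbre]
  have h1 : (1 - w * Complex.I : ℂ) ≠ 0 := fun h => by simpa using congrArg Complex.re h
  have h2 : (1 + w * Complex.I : ℂ) ≠ 0 := fun h => by simpa using congrArg Complex.re h
  have h3 : (1 + (w : ℂ) ^ 2) = (1 - w * Complex.I) * (1 + w * Complex.I) := by
    ring_nf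
    simp
  push_cast
  rw [h3, ha, hb]
  simp only [mul_zero, Complex.exp_zero]
  field_simp
  ring

lemma integral_cos_mul_inv_one_add_sq (x : ℝ) :
    ∫ w : ℝ, Real.cos (x * w) * (1 + w ^ 2)⁻¹ = Real.pi * Real.exp (-|x|) := by
  have hpi := Real.pi_pos
  have hF : 𝓕 (fun t : ℝ => (Real.exp (-(2 * Real.pi * |t|)) : ℂ)) =
      fun w : ℝ => (((1 + w ^ 2)⁻¹ / Real.pi : ℝ) : ℂ) := funext fourier_exp_neg_abs
  have hint : Integrable (fun w : ℝ => (((1 + w ^ 2)⁻¹ / Real.pi : ℝ) : ℂ)) :=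
    (integrable_inv_one_add_sq.div_const _).ofReal
  have hcont : Continuous (fun t : ℝ => (Real.exp (-(2 * Real.pi * |t|)) : ℂ)) := by fun_prop
  have h := congrFun (hcont.fourierInv_fourier_eq integrable_exp_neg_abs (hF ▸ hint))
    (x / (2 * Real.pi))
  rw [hF, Real.fourierInv_eq'] at h
  have hint2 : Integrable (fun w : ℝ => Complex.exp
      (((2 * Real.pi * inner ℝ w (x / (2 * Real.pi)) : ℝ) : ℂ) * Complex.I) •
        (((1 + w ^ 2)⁻¹ / Real.pi : ℝ) : ℂ)) := by
    refine (hint.bdd_mul (c := 1) (by fun_prop) (.of_forall fun w => ?_))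
    rw [Complex.norm_exp_ofReal_mul_I]
  have h' := congrArg RCLike.re h
  rw [← integral_re hint2] at h'
  have e1 : |x / (2 * Real.pi)| = |x| / (2 * Real.pi) := by
    rw [abs_div, abs_of_pos (by positivity : 0 < 2 * Real.pi)]
  have e2 : ∀ w : ℝ, RCLike.re (Complex.exp
      (((2 * Real.pi * inner ℝ w (x / (2 * Real.pi)) : ℝ) : ℂ) * Complex.I) •
        (((1 + w ^ 2)⁻¹ / Real.pi : ℝ) : ℂ)) =
      Real.cos (x * w) * (1 + w ^ 2)⁻¹ / Real.pi := by
    intro w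
    have e3 : 2 * Real.pi * inner ℝ w (x / (2 * Real.pi)) = x * w := by
      simp only [RCLike.inner_apply, conj_trivial]
      field_simp
    rw [e3, smul_eq_mul, RCLike.re_to_complex, Complex.re_mul_ofReal,
      Complex.exp_ofReal_mul_I_re]
    ring
  simp_rw [e2] at h'
  rw [integral_div, RCLike.re_to_complex, Complex.ofReal_re, e1] at h'
  rw [div_eq_iff hpi.ne'] at h'
  rw [h', mul_div_cancel₀ _ (by positivity), mul_comm]

end CauchyIntegral

section Bateman

lemma batemanK_zero_left (x : ℝ) : batemanK 0 x = Real.exp (-|x|) := by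
  have hpi := Real.pi_pos
  have himg : Real.arctan '' Ioi 0 = Ioo 0 (Real.pi / 2) := by
    ext θ
    constructor
    · rintro ⟨t, ht, rfl⟩
      exact ⟨Real.arctan_pos.2 ht, Real.arctan_lt_pi_div_two t⟩
    · rintro ⟨h0, h1⟩
      exact ⟨Real.tan θ, Real.tan_pos_of_pos_of_lt_pi_div_two h0 h1,
        Real.arctan_tan (by linarith) h1⟩
  have hsub : ∫ θ in (0:ℝ)..(Real.pi / 2), Real.cos (x * Real.tan θ - 0 * θ) =
      ∫ t in Ioi (0 : ℝ), Real.cos (x * t) * (1 + t ^ 2)⁻¹ := by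
    rw [intervalIntegral.integral_of_le (by positivity), integral_Ioc_eq_integral_Ioo, ← himg,
      integral_image_eq_integral_abs_deriv_smul measurableSet_Ioi
        (fun t _ => (Real.hasDerivAt_arctan' t).hasDerivWithinAt) Real.arctan_injective.injOn]
    refine setIntegral_congr_fun measurableSet_Ioi fun t _ => ?_
    simp only [Real.tan_arctan, zero_mul, sub_zero, smul_eq_mul]
    rw [abs_of_pos (by positivity), mul_comm]
  have habs := integral_comp_abs (f := fun t : ℝ => Real.cos (x * t) * (1 + t ^ 2)⁻¹)
  have heq : ∀ t : ℝ, Real.cos (x * |t|) * (1 + |t| ^ 2)⁻¹ =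
      Real.cos (x * t) * (1 + t ^ 2)⁻¹ := by
    intro t
    rw [sq_abs, ← Real.cos_abs (x * |t|), ← Real.cos_abs (x * t), abs_mul, abs_mul, abs_abs]
  simp_rw [heq, integral_cos_mul_inv_one_add_sq] at habs
  rw [batemanK, hsub, div_mul_eq_mul_div, ← habs, mul_div_cancel_left₀ _ hpi.ne']

lemma measurable_real_tan : Measurable Real.tan := by
  rw [funext Real.tan_eq_sin_div_cos]
  fun_prop

lemma intervalIntegrable_cos_tan (ν x : ℝ) :
    IntervalIntegrable (fun θ => Real.cos (x * Real.tan θ - ν * θ)) volume 0 (Real.pi / 2) := by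
  have htan := measurable_real_tan
  refine (intervalIntegrable_const (c := (1 : ℝ))).mono_fun (by fun_prop) (.of_forall fun θ => ?_)
  simpa using Real.abs_cos_le_one _

lemma hasDerivAt_batemanK_add (ν x : ℝ) :
    HasDerivAt (fun y => batemanK ν y + batemanK (ν + 2) y)
      (batemanK ν x - batemanK (ν + 2) x) x := by
  have htan := measurable_real_tan
  have hfun : (fun y => batemanK ν y + batemanK (ν + 2) y) = fun y => (2 / Real.pi) *
      ∫ θ in (0:ℝ)..(Real.pi / 2),
        (Real.cos (y * Real.tan θ - ν * θ) + Real.cos (y * Real.tan θ - (ν + 2) * θ)) := by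
    funext y
    rw [intervalIntegral.integral_add (intervalIntegrable_cos_tan _ _)
      (intervalIntegrable_cos_tan _ _), batemanK, batemanK]
    ring
  rw [hfun, batemanK, batemanK, ← mul_sub, ← intervalIntegral.integral_sub
    (intervalIntegrable_cos_tan _ _) (intervalIntegrable_cos_tan _ _)]
  refine HasDerivAt.const_mul _ ?_
  have hne : ∀ᵐ θ : ℝ, θ ≠ Real.pi / 2 := by simp [ae_iff]
  refine (intervalIntegral.hasDerivAt_integral_of_dominated_loc_of_deriv_le
    (F := fun y θ => Real.cos (y * Real.tan θ - ν * θ) + Real.cos (y * Real.tan θ - (ν + 2) * θ))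
    (F' := fun y θ => Real.cos (y * Real.tan θ - ν * θ) - Real.cos (y * Real.tan θ - (ν + 2) * θ))
    (bound := fun _ => 2) (s := univ) Filter.univ_mem
    (.of_forall fun y => by fun_prop)
    ((intervalIntegrable_cos_tan _ _).add (intervalIntegrable_cos_tan _ _))
    (by fun_prop) (.of_forall fun θ _ y _ => ?_) intervalIntegrable_const ?_).2
  · calc _ ≤ |Real.cos (y * Real.tan θ - ν * θ)| + |Real.cos (y * Real.tan θ - (ν + 2) * θ)| :=
        abs_sub _ _
      _ ≤ 2 := by linarith [Real.abs_cos_le_one (y * Real.tan θ - ν * θ),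
          Real.abs_cos_le_one (y * Real.tan θ - (ν + 2) * θ)]
  · filter_upwards [hne] with θ hθ hmem y _
    rw [uIoc_of_le (by positivity)] at hmem
    have hcos : Real.cos θ ≠ 0 := (Real.cos_pos_of_mem_Ioo
      ⟨by linarith [hmem.1, Real.pi_pos], lt_of_le_of_ne hmem.2 hθ⟩).ne'
    have hd : ∀ μ : ℝ, HasDerivAt (fun y => Real.cos (y * Real.tan θ - μ * θ))
        (-Real.sin (y * Real.tan θ - μ * θ) * (1 * Real.tan θ)) y := fun μ =>
      (((hasDerivAt_id' y).mul_const _).sub_const _).cos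
    refine ((hd ν).add (hd (ν + 2))).congr_deriv ?_
    have e1 : y * Real.tan θ - ν * θ = (y * Real.tan θ - (ν + 1) * θ) + θ := by ring
    have e2 : y * Real.tan θ - (ν + 2) * θ = (y * Real.tan θ - (ν + 1) * θ) - θ := by ring
    rw [e1, e2]
    generalize y * Real.tan θ - (ν + 1) * θ = A
    rw [Real.sin_add, Real.sin_sub, Real.cos_add, Real.cos_sub]
    linear_combination (-2 * Real.sin A) * Real.tan_mul_cos hcos

lemma batemanK_two_mul_zero {n : ℕ} (hn : n ≠ 0) : batemanK (2 * n) 0 = 0 := by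
  have hn' : (n : ℝ) ≠ 0 := by exact_mod_cast hn
  have h : ∫ θ in (0:ℝ)..(Real.pi / 2), Real.cos (0 * Real.tan θ - 2 * n * θ) = 0 := by
    simp only [zero_mul, zero_sub, Real.cos_neg]
    rw [intervalIntegral.integral_comp_mul_left (fun t => Real.cos t) (by positivity), integral_cos]
    have : 2 * (n : ℝ) * (Real.pi / 2) = n * Real.pi := by ring
    simp [this, Real.sin_nat_mul_pi]
  rw [batemanK, h, mul_zero]

lemma batemanK_add_two_eq_of_hasDerivAt {ν : ℝ} {a b : ℝ → ℝ}
    (ha : ∀ x, 0 ≤ x → batemanK ν x = a x) (hb : batemanK (ν + 2) 0 = b 0)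
    (hab : ∀ x, HasDerivAt (fun y => a y + b y) (a x - b x) x) {x : ℝ} (hx : 0 ≤ x) :
    batemanK (ν + 2) x = b x := by
  set g : ℝ → ℝ := fun y => Real.exp y * (batemanK ν y + batemanK (ν + 2) y - (a y + b y)) with hg
  have hd : ∀ y, HasDerivAt g (2 * Real.exp y * (batemanK ν y - a y)) y := fun y =>
    ((Real.hasDerivAt_exp y).mul ((hasDerivAt_batemanK_add ν y).sub (hab y))).congr_deriv
      (by simp only [Pi.sub_apply]; ring)
  have h := constant_of_has_deriv_right_zero (f := g) (a := 0) (b := x)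
    (fun y _ => (hd y).continuousAt.continuousWithinAt)
    (fun y hy => by
      have := (hd y).hasDerivWithinAt (s := Ici y)
      rwa [ha y hy.1, sub_self, mul_zero] at this) x ⟨hx, le_rfl⟩
  simp only [hg, ha x hx, ha 0 le_rfl, hb, sub_self, mul_zero] at h
  have := (mul_eq_zero.1 h).resolve_left (Real.exp_pos x).ne'
  linarith

end Bateman

section Rodrigues

open scoped ContDiff

lemma ContDiff.hasDerivAt_iteratedDeriv {f : ℝ → ℝ} (hf : ContDiff ℝ ∞ f) (n : ℕ) (x : ℝ) :
    HasDerivAt (iteratedDeriv n f) (iteratedDeriv (n + 1) f x) x := by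
  rw [iteratedDeriv_succ]
  exact (hf.differentiable_iteratedDeriv n (by exact_mod_cast ENat.natCast_lt_top n) x).hasDerivAt

lemma iteratedDeriv_succ_id_mul {f : ℝ → ℝ} (hf : ContDiff ℝ ∞ f) (n : ℕ) (x : ℝ) :
    iteratedDeriv (n + 1) (fun t => t * f t) x =
      x * iteratedDeriv (n + 1) f x + (n + 1) * iteratedDeriv n f x := by
  induction n generalizing x with
  | zero =>
    have h := (hasDerivAt_id' x).mul (hf.hasDerivAt_iteratedDeriv 0 x)
    simp only [zero_add, iteratedDeriv_one, iteratedDeriv_zero] at h ⊢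
    refine (HasDerivAt.deriv h).trans ?_
    push_cast
    ring
  | succ n ih =>
    rw [iteratedDeriv_succ, funext ih]
    have h := ((hasDerivAt_id' x).mul (hf.hasDerivAt_iteratedDeriv (n + 1) x)).add
      ((hf.hasDerivAt_iteratedDeriv n x).const_mul ((n : ℝ) + 1))
    refine (HasDerivAt.deriv h).trans ?_
    push_cast
    ring

lemma contDiff_pow_mul_exp (m : ℕ) :
    ContDiff ℝ ∞ (fun t : ℝ => t ^ m * Real.exp (-2 * t)) := by
  fun_prop

lemma iteratedDeriv_pow_succ_mul_exp (m : ℕ) (x : ℝ) :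
    iteratedDeriv (m + 2) (fun t : ℝ => t ^ (m + 1) * Real.exp (-2 * t)) x =
      x * iteratedDeriv (m + 2) (fun t : ℝ => t ^ m * Real.exp (-2 * t)) x +
      (m + 2) * iteratedDeriv (m + 1) (fun t : ℝ => t ^ m * Real.exp (-2 * t)) x := by
  have e : (fun t : ℝ => t ^ (m + 1) * Real.exp (-2 * t)) =
      fun t => t * (t ^ m * Real.exp (-2 * t)) := by funext t; ring
  rw [e, iteratedDeriv_succ_id_mul (contDiff_pow_mul_exp m)]
  push_cast
  ring

lemma iteratedDeriv_pow_succ_mul_exp' (m : ℕ) (x : ℝ) :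
    iteratedDeriv (m + 2) (fun t : ℝ => t ^ (m + 1) * Real.exp (-2 * t)) x =
      (m + 1 - 2 * x) * iteratedDeriv (m + 1) (fun t : ℝ => t ^ m * Real.exp (-2 * t)) x -
      2 * (m + 1) * iteratedDeriv m (fun t : ℝ => t ^ m * Real.exp (-2 * t)) x := by
  have e : (fun t : ℝ => t ^ (m + 1) * Real.exp (-2 * t)) =
      fun t => t * (t ^ m * Real.exp (-2 * t)) := by funext t; ring
  have hd : deriv (fun t : ℝ => t ^ (m + 1) * Real.exp (-2 * t)) = fun t =>
      ((m : ℝ) + 1) * (t ^ m * Real.exp (-2 * t)) -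
        2 * (t ^ (m + 1) * Real.exp (-2 * t)) := by
    funext t
    have h := (hasDerivAt_pow (m + 1) t).mul ((hasDerivAt_id' t).const_mul (-2 : ℝ)).exp
    refine (HasDerivAt.deriv h).trans ?_
    push_cast
    ring
  have h1 : ContDiffAt ℝ (m + 1 : ℕ) (fun t : ℝ => t ^ m * Real.exp (-2 * t)) x := by fun_prop
  have h2 : ContDiffAt ℝ (m + 1 : ℕ) (fun t : ℝ => t ^ (m + 1) * Real.exp (-2 * t)) x := by
    fun_prop
  rw [iteratedDeriv_succ', hd]
  refine (iteratedDeriv_sub (contDiffAt_const.mul h1) (contDiffAt_const.mul h2)).trans ?_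
  rw [iteratedDeriv_const_mul _ h1, iteratedDeriv_const_mul _ h2, e,
    iteratedDeriv_succ_id_mul (contDiff_pow_mul_exp m)]
  ring

/-- The right-hand side of the Rodrigues formula for `batemanK (2 * (m + 1))`. -/
noncomputable def rodriguesBateman (m : ℕ) (x : ℝ) : ℝ :=
  ((-1 : ℝ) ^ (m + 1) * x * Real.exp x / (m + 1).factorial) *
    iteratedDeriv (m + 1) (fun t : ℝ => t ^ m * Real.exp (-2 * t)) x

lemma hasDerivAt_rodriguesBateman (m : ℕ) (x : ℝ) :
    HasDerivAt (rodriguesBateman m)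
      ((-1 : ℝ) ^ (m + 1) / (m + 1).factorial * Real.exp x *
        ((1 + x) * iteratedDeriv (m + 1) (fun t : ℝ => t ^ m * Real.exp (-2 * t)) x +
          x * iteratedDeriv (m + 2) (fun t : ℝ => t ^ m * Real.exp (-2 * t)) x)) x := by
  have h := ((((hasDerivAt_id' x).const_mul ((-1 : ℝ) ^ (m + 1))).mul
    (Real.hasDerivAt_exp x)).div_const ((m + 1).factorial : ℝ)).mul
    ((contDiff_pow_mul_exp m).hasDerivAt_iteratedDeriv (m + 1) x)
  refine h.congr_deriv ?_
  simp only [Pi.mul_apply]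
  ring

lemma hasDerivAt_rodriguesBateman_add (m : ℕ) (x : ℝ) :
    HasDerivAt (fun y => rodriguesBateman m y + rodriguesBateman (m + 1) y)
      (rodriguesBateman m x - rodriguesBateman (m + 1) x) x := by
  have hw : ∀ y, iteratedDeriv (m + 2) (fun t : ℝ => t ^ (m + 1) * Real.exp (-2 * t)) y = _ :=
    iteratedDeriv_pow_succ_mul_exp' m
  have hw' : iteratedDeriv (m + 3) (fun t : ℝ => t ^ (m + 1) * Real.exp (-2 * t)) x =
      (m + 1 - 2 * x) * iteratedDeriv (m + 2) (fun t : ℝ => t ^ m * Real.exp (-2 * t)) x -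
      (2 * m + 4) * iteratedDeriv (m + 1) (fun t : ℝ => t ^ m * Real.exp (-2 * t)) x := by
    rw [iteratedDeriv_succ, funext hw]
    have hs := contDiff_pow_mul_exp m
    have h := ((((hasDerivAt_id' x).const_mul (2 : ℝ)).const_sub ((m : ℝ) + 1)).mul
      (hs.hasDerivAt_iteratedDeriv (m + 1) x)).sub
      ((hs.hasDerivAt_iteratedDeriv m x).const_mul (2 * ((m : ℝ) + 1)))
    refine (HasDerivAt.deriv h).trans ?_
    ring
  refine ((hasDerivAt_rodriguesBateman m x).add
    (hasDerivAt_rodriguesBateman (m + 1) x)).congr_deriv ?_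
  have hu := iteratedDeriv_pow_succ_mul_exp m x
  have hf : (((m + 1 + 1).factorial : ℕ) : ℝ) = (m + 2) * (m + 1).factorial := by
    rw [Nat.factorial_succ]
    push_cast
    ring
  have hne : ((m + 1).factorial : ℝ) ≠ 0 := by positivity
  have hm : (m : ℝ) + 2 ≠ 0 := by positivity
  simp only [rodriguesBateman, hf]
  rw [show m + 1 + 2 = m + 3 from rfl, show m + 1 + 1 = m + 2 from rfl, hw', hu]
  field_simp
  ring

end Rodrigues

lemma batemanK_two_mul_succ (m : ℕ) {x : ℝ} (hx : 0 ≤ x) :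
    batemanK (2 * (m + 1 : ℕ)) x = rodriguesBateman m x := by
  have hzero : ∀ m : ℕ, batemanK (2 * (m + 1 : ℕ)) 0 = rodriguesBateman m 0 := fun m => by
    rw [batemanK_two_mul_zero m.succ_ne_zero, rodriguesBateman]
    simp
  induction m generalizing x with
  | zero =>
    have e : (2 * ((0 + 1 : ℕ) : ℝ)) = 0 + 2 := by norm_num
    have hR : ∀ y, rodriguesBateman 0 y = 2 * y * Real.exp (-y) := fun y => by
      have hd : deriv (fun t : ℝ => Real.exp (-2 * t)) y = Real.exp (-2 * y) * (-2 * 1) :=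
        ((hasDerivAt_id' y).const_mul (-2 : ℝ)).exp.deriv
      have he : Real.exp (-y) = Real.exp y * Real.exp (-2 * y) := by
        rw [← Real.exp_add]
        ring_nf
      simp only [rodriguesBateman, zero_add, pow_zero, one_mul, iteratedDeriv_one, hd, he,
        Nat.factorial_one]
      push_cast
      ring
    have h0 := hzero 0
    rw [e] at h0 ⊢
    refine batemanK_add_two_eq_of_hasDerivAt (a := fun y => Real.exp (-y))
      (fun y hy => by rw [batemanK_zero_left, abs_of_nonneg hy]) h0 (fun y => ?_) hx
    have h : HasDerivAt (fun y : ℝ => Real.exp (-y)) (Real.exp (-y) * -1) y :=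
      (hasDerivAt_id' y).neg.exp
    simp only [hR]
    refine (h.add (((hasDerivAt_id' y).const_mul (2 : ℝ)).mul h)).congr_deriv ?_
    ring
  | succ m ih =>
    have e : (2 * ((m + 1 + 1 : ℕ) : ℝ)) = 2 * ((m + 1 : ℕ) : ℝ) + 2 := by
      push_cast
      ring
    have h0 := hzero (m + 1)
    rw [e] at h0 ⊢
    exact batemanK_add_two_eq_of_hasDerivAt (fun y hy => ih hy) h0
      (hasDerivAt_rodriguesBateman_add m) hx

theorem bateman_rodrigues (n : ℕ) (hn : 1 ≤ n) (x : ℝ) (hx : 0 < x) :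
    batemanK (2 * n) x =
      ((-1 : ℝ) ^ n * x * Real.exp x / n.factorial) *
        iteratedDeriv n (fun t : ℝ => t ^ (n - 1) * Real.exp (-2 * t)) x := by
  obtain ⟨m, rfl⟩ := Nat.exists_eq_add_of_le' hn
  exact batemanK_two_mul_succ m hx.le
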